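/- arXiv:1609.03128 — 3 statements merged into one kernel-verified Lean document; each statement's English description precedes it below -/
import Mathlib

section
/- For every n ≥ 1 and every lattice path π ∈ L_{n,n}, dinv_C(π) = area(ζ_C(π)). -/
inductive Step
  | N : Step
  | E : Step
  deriving DecidableEq

/-- The number of East steps strictly preceding the `k`-th North step. -/
def ebn : List Step → ℕ → ℕ
  | _, 0 => 0
  | [], _ + 1 => 0
  | Step.E :: rest, k + 1 => ebn rest (k + 1) + 1
  | Step.N :: rest, k + 1 => ebn rest k

/-- A lattice path with `a` East steps and `b` North steps. -/
def IsLatticePath (a b : ℕ) (π : List Step) : Prop :=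
  π.count Step.E = a ∧ π.count Step.N = b

/-- A ballot path of length `m`: every prefix has at least as many `N`s as `E`s. -/
def IsBallotPath (m : ℕ) (β : List Step) : Prop :=
  β.length = m ∧ ∀ k : ℕ, (β.take k).count Step.E ≤ (β.take k).count Step.N

/-- `i` is a rise: the `i`-th North step is immediately followed by a North step. -/
def IsRise (π : List Step) (i : ℕ) : Prop :=
  ∃ p : ℕ, π[p]? = some Step.N ∧ π[p + 1]? = some Step.N ∧ (π.take p).count Step.N + 1 = i

/-- `(i,j)` is a valley: the `i`-th East step is immediately followed by the `j`-th North
step; in addition if the path ends with an East step and consists of `i` East steps and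
`j - 1` North steps, then `(i, j)` counts as a valley. -/
def IsValley (β : List Step) (i j : ℕ) : Prop :=
  (∃ p : ℕ, β[p]? = some Step.E ∧ β[p + 1]? = some Step.N ∧
      (β.take p).count Step.E + 1 = i ∧ (β.take (p + 1)).count Step.N + 1 = j) ∨
  (β.getLast? = some Step.E ∧ i = β.count Step.E ∧ j = β.count Step.N + 1)

/-- Read `a` from left to right, writing `N` for each entry `j` and `E` for each entry `j+1`. -/
def sPlusL (j : ℤ) (a : List ℤ) : List Step :=
  a.filterMap fun x => if x = j then some Step.N else if x = j + 1 then some Step.E else none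

/-- Read `a` from right to left, writing `N` for each entry `j` and `E` for each entry `j+1`. -/
def sPlusR (j : ℤ) (a : List ℤ) : List Step := sPlusL j a.reverse

/-- Read `a` from left to right, writing `N` for each entry `-j` and `E` for each entry `-j-1`. -/
def sMinusL (j : ℤ) (a : List ℤ) : List Step :=
  a.filterMap fun x => if x = -j then some Step.N else if x = -j - 1 then some Step.E else none

/-- Read `a` from right to left, writing `N` for each entry `-j` and `E` for each entry `-j-1`. -/
def sMinusR (j : ℤ) (a : List ℤ) : List Step := sMinusL j a.reverse

/-- The type `Cₙ` area vector of a lattice path, `μ k = (n+1-k) - λ_{n+1-k}` (1-based). -/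
def areaC (n : ℕ) (π : List Step) (k : ℕ) : ℤ :=
  ((n : ℤ) + 1 - k) - ebn π (n + 1 - k)

def areaCList (n : ℕ) (π : List Step) : List ℤ :=
  (List.range n).map fun k => areaC n π (k + 1)

/-- The type `Cₙ` zeta map. -/
def zetaC (n : ℕ) (π : List Step) : List Step :=
  ((List.range (n + 1)).reverse.map (fun j =>
    sMinusR (j : ℤ) (areaCList n π) ++ sPlusL (j : ℤ) (areaCList n π))).flatten

/-- `eI n k` is the standard basis vector `e_k` (1-based); zero if `k` is out of range. -/
def eI (n : ℕ) (k : ℕ) : Fin n → ℤ := fun t => if t.val + 1 = k then 1 else 0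

/-- The positive roots of type `Cₙ`. -/
def PosRootsC (n : ℕ) : Set (Fin n → ℤ) :=
  {x | (∃ i j : ℕ, 1 ≤ i ∧ i < j ∧ j ≤ n ∧ (x = eI n j - eI n i ∨ x = eI n j + eI n i)) ∨
       (∃ i : ℕ, 1 ≤ i ∧ i ≤ n ∧ x = (2 : ℤ) • eI n i)}

/-- The root poset order: `α ≤ β` iff `β - α` is a sum of positive roots. -/
def rootLE (n : ℕ) (α β : Fin n → ℤ) : Prop :=
  β - α ∈ AddSubmonoid.closure (PosRootsC n)

/-- The positive root associated to a valley `(i,j)` of a ballot path in `B_{2n}`. -/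
def rootOfValleyC (n : ℕ) (i j : ℕ) : Fin n → ℤ :=
  if j ≤ n then eI n (n + 1 - i) - eI n (n + 1 - j)
  else eI n (n + 1 - i) + eI n (j - n)

/-- The antichain `A_β` of a ballot path `β`. -/
def antichainC (n : ℕ) (β : List Step) : Set (Fin n → ℤ) :=
  {α | ∃ i j : ℕ, IsValley β i j ∧ α = rootOfValleyC n i j}

/-- The order ideal `I_β` of positive roots not above any element of `A_β`. -/
def idealC (n : ℕ) (β : List Step) : Set (Fin n → ℤ) :=
  {x | x ∈ PosRootsC n ∧ ¬ ∃ y ∈ antichainC n β, rootLE n y x}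

/-- `area β = |I_β|`. -/
noncomputable def areaStatC (n : ℕ) (β : List Step) : ℕ := (idealC n β).ncard

/-- The type `Cₙ` diagonal inversion statistic. -/
def dinvC (n : ℕ) (π : List Step) : ℕ :=
  (Finset.univ.filter (fun p : Fin n × Fin n =>
    p.1 < p.2 ∧ areaC n π (n - p.1.val) = areaC n π (n - p.2.val))).card +
  (Finset.univ.filter (fun p : Fin n × Fin n =>
    p.1 < p.2 ∧ areaC n π (n - p.1.val) = areaC n π (n - p.2.val) + 1)).card +
  (Finset.univ.filter (fun p : Fin n × Fin n =>
    p.1 < p.2 ∧ areaC n π (n - p.1.val) = -areaC n π (n - p.2.val))).card +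
  (Finset.univ.filter (fun p : Fin n × Fin n =>
    p.1 < p.2 ∧ areaC n π (n - p.1.val) = -areaC n π (n - p.2.val) + 1)).card +
  (Finset.univ.filter (fun i : Fin n => areaC n π (n - i.val) = 0)).card


/-- The number of pairs formed by an East step and a later North step. -/
def eastNorthPairs : List Step → ℕ
  | [] => 0
  | Step.E :: r => eastNorthPairs r + r.count Step.N
  | Step.N :: r => eastNorthPairs r

/-- The sum of `f x y` over all pairs of entries `x`, `y` of a list with `x` to the left of `y`. -/
def pairSum {α : Type*} (f : α → α → ℕ) : List α → ℕ
  | [] => 0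
  | x :: l => (l.map (f x)).sum + pairSum f l

lemma eastNorthPairs_append (u w : List Step) :
    eastNorthPairs (u ++ w) =
      eastNorthPairs u + eastNorthPairs w + u.count Step.E * w.count Step.N := by
  induction u with
  | nil => simp [eastNorthPairs]
  | cons s u ih =>
    cases s
    · simp [eastNorthPairs, ih]
    · simp [eastNorthPairs, ih, List.count_append]
      ring

lemma sum_map_add_nat {α : Type*} (f g : α → ℕ) (l : List α) :
    (l.map fun x => f x + g x).sum = (l.map f).sum + (l.map g).sum := by
  induction l with
  | nil => simp
  | cons x l ih => simp [ih]; omega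

lemma pairSum_add {α : Type*} (f g : α → α → ℕ) (l : List α) :
    pairSum (fun x y => f x y + g x y) l = pairSum f l + pairSum g l := by
  induction l with
  | nil => simp [pairSum]
  | cons x l ih => simp only [pairSum, ih, sum_map_add_nat]; omega

lemma pairSum_concat {α : Type*} (f : α → α → ℕ) (l : List α) (y : α) :
    pairSum f (l ++ [y]) = pairSum f l + (l.map fun x => f x y).sum := by
  induction l with
  | nil => simp [pairSum]
  | cons x l ih => simp [pairSum, ih]; omega

lemma pairSum_reverse {α : Type*} (f : α → α → ℕ) (l : List α) :
    pairSum f l.reverse = pairSum (fun x y => f y x) l := by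
  induction l with
  | nil => simp [pairSum]
  | cons x l ih => simp [pairSum, pairSum_concat, ih, List.sum_reverse]; omega

lemma pairSum_congr {α : Type*} {f g : α → α → ℕ} {l : List α}
    (h : ∀ x ∈ l, ∀ y ∈ l, f x y = g x y) : pairSum f l = pairSum g l := by
  induction l with
  | nil => simp [pairSum]
  | cons x l ih =>
    simp only [pairSum]
    rw [ih fun y hy z hz => h y (by simp [hy]) z (by simp [hz]),
      List.map_congr_left fun y hy => h x (by simp) y (by simp [hy])]

lemma sum_mul_sum_eq_pairSum {α : Type*} (f g : α → ℕ) (l : List α) :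
    (l.map f).sum * (l.map g).sum =
      pairSum (fun x y => f x * g y + f y * g x) l + (l.map fun x => f x * g x).sum := by
  induction l with
  | nil => simp [pairSum]
  | cons x l ih =>
    simp only [pairSum, List.map_cons, List.sum_cons, sum_map_add_nat, List.sum_map_mul_left,
      List.sum_map_mul_right]
    linarith

lemma count_filterMap_eq_sum {α : Type*} (φ : α → Option Step) (s : Step) (l : List α) :
    (l.filterMap φ).count s = (l.map fun x => if φ x = some s then 1 else 0).sum := by
  induction l with
  | nil => simp
  | cons x l ih =>
    rcases h : φ x with _ | t
    · simp [h, ih]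
    · simp [h, ih, List.count_cons]; omega

lemma eastNorthPairs_filterMap {α : Type*} (φ : α → Option Step) (l : List α) :
    eastNorthPairs (l.filterMap φ) =
      pairSum (fun x y => (if φ x = some Step.E then 1 else 0) *
        (if φ y = some Step.N then 1 else 0)) l := by
  induction l with
  | nil => simp [eastNorthPairs, pairSum]
  | cons x l ih =>
    rcases h : φ x with _ | s
    · simp [h, ih, pairSum]
    · cases s
      · simp [h, ih, pairSum, eastNorthPairs]
      · simp [h, ih, pairSum, eastNorthPairs, count_filterMap_eq_sum]; omega

lemma count_east_add_count_north (l : List Step) :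
    l.count Step.E + l.count Step.N = l.length := by
  induction l with
  | nil => simp
  | cons s l ih => cases s <;> simp <;> omega

/-! ### The blocks of the zeta map -/

/-- The last `2 * J` blocks of the zeta map, for an arbitrary integer vector. -/
def zetaTail (J : ℕ) (a : List ℤ) : List Step :=
  ((List.range J).reverse.map fun j : ℕ => sMinusR (j : ℤ) a ++ sPlusL (j : ℤ) a).flatten

lemma zetaTail_succ (J : ℕ) (a : List ℤ) :
    zetaTail (J + 1) a = sMinusR J a ++ sPlusL J a ++ zetaTail J a := by
  simp [zetaTail, List.range_succ]

lemma count_north_sPlusL (j : ℤ) (a : List ℤ) :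
    (sPlusL j a).count Step.N = (a.map fun x => if x = j then 1 else 0).sum := by
  rw [sPlusL, count_filterMap_eq_sum]
  congr 1
  refine List.map_congr_left fun x _ => ?_
  split_ifs <;> simp_all

lemma count_east_sPlusL (j : ℤ) (a : List ℤ) :
    (sPlusL j a).count Step.E = (a.map fun x => if x = j + 1 then 1 else 0).sum := by
  rw [sPlusL, count_filterMap_eq_sum]
  congr 1
  refine List.map_congr_left fun x _ => ?_
  split_ifs <;> simp_all

lemma count_north_sMinusR (j : ℤ) (a : List ℤ) :
    (sMinusR j a).count Step.N = (a.map fun x => if x = -j then 1 else 0).sum := by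
  rw [sMinusR, sMinusL, List.filterMap_reverse, List.count_reverse, count_filterMap_eq_sum]
  congr 1
  refine List.map_congr_left fun x _ => ?_
  split_ifs <;> simp_all

lemma count_east_sMinusR (j : ℤ) (a : List ℤ) :
    (sMinusR j a).count Step.E = (a.map fun x => if x = -j - 1 then 1 else 0).sum := by
  rw [sMinusR, sMinusL, List.filterMap_reverse, List.count_reverse, count_filterMap_eq_sum]
  congr 1
  refine List.map_congr_left fun x _ => ?_
  split_ifs <;> simp_all

lemma eastNorthPairs_sPlusL (j : ℤ) (a : List ℤ) :
    eastNorthPairs (sPlusL j a) =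
      pairSum (fun x y => (if x = j + 1 then 1 else 0) * (if y = j then 1 else 0)) a := by
  rw [sPlusL, eastNorthPairs_filterMap]
  congr 1
  funext x y
  split_ifs <;> simp_all

lemma eastNorthPairs_sMinusR (j : ℤ) (a : List ℤ) :
    eastNorthPairs (sMinusR j a) =
      pairSum (fun x y => (if y = -j - 1 then 1 else 0) * (if x = -j then 1 else 0)) a := by
  rw [sMinusR, sMinusL, eastNorthPairs_filterMap, pairSum_reverse]
  congr 1
  funext x y
  split_ifs <;> simp_all

/-- The number of North steps of `zetaTail J` coming from an entry `x`. -/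
def northWeight (J : ℕ) (x : ℤ) : ℕ :=
  (if 0 ≤ x ∧ x < J then 1 else 0) + (if -J < x ∧ x ≤ 0 then 1 else 0)

/-- The number of East steps of `zetaTail J` coming from an entry `x`. -/
def eastWeight (J : ℕ) (x : ℤ) : ℕ := if x ≠ 0 ∧ -J ≤ x ∧ x ≤ J then 1 else 0

lemma count_north_zetaTail (J : ℕ) (a : List ℤ) :
    (zetaTail J a).count Step.N = (a.map (northWeight J)).sum := by
  induction J with
  | zero =>
    rw [List.map_congr_left (g := fun _ => 0)
      fun x _ => by simp only [northWeight]; split_ifs <;> omega]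
    simp [zetaTail]
  | succ J ih =>
    rw [zetaTail_succ, List.count_append, List.count_append, ih, count_north_sMinusR,
      count_north_sPlusL, ← sum_map_add_nat, ← sum_map_add_nat]
    congr 1
    refine List.map_congr_left fun x _ => ?_
    simp only [northWeight]
    push_cast
    split_ifs <;> omega

lemma count_east_zetaTail (J : ℕ) (a : List ℤ) :
    (zetaTail J a).count Step.E = (a.map (eastWeight J)).sum := by
  induction J with
  | zero =>
    rw [List.map_congr_left (g := fun _ => 0)
      fun x _ => by simp only [eastWeight]; split_ifs <;> omega]
    simp [zetaTail]
  | succ J ih =>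
    rw [zetaTail_succ, List.count_append, List.count_append, ih, count_east_sMinusR,
      count_east_sPlusL, ← sum_map_add_nat, ← sum_map_add_nat]
    congr 1
    refine List.map_congr_left fun x _ => ?_
    simp only [eastWeight]
    push_cast
    split_ifs <;> omega

/-- The number of pairs of `zetaTail (J + 1)` formed by an East step in one of the two blocks of
index `J`, coming from an entry `x`, and a later North step, coming from an entry `y` to the
right of `x`. -/
def eastLeftTerm (J : ℕ) (x y : ℤ) : ℕ :=
  (if x = (J : ℤ) + 1 then 1 else 0) * ((if y = (J : ℤ) then 1 else 0) + northWeight J y) +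
  (if x = -(J : ℤ) - 1 then 1 else 0) * ((if y = (J : ℤ) then 1 else 0) + northWeight J y)

/-- The analogue of `eastLeftTerm` for a North step coming from an entry `x` and an East step
coming from an entry `y` to the right of `x`. -/
def eastRightTerm (J : ℕ) (x y : ℤ) : ℕ :=
  (if y = (J : ℤ) + 1 then 1 else 0) * northWeight J x +
  (if y = -(J : ℤ) - 1 then 1 else 0) *
    ((if x = -(J : ℤ) then 1 else 0) + (if x = (J : ℤ) then 1 else 0) + northWeight J x)

lemma eastNorthPairs_zetaTail (J : ℕ) (a : List ℤ) :
    eastNorthPairs (zetaTail J a) =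
      pairSum (fun x y => ∑ j ∈ Finset.range J, (eastLeftTerm j x y + eastRightTerm j x y)) a := by
  induction J with
  | zero =>
    simp only [zetaTail, List.range_zero, List.reverse_nil, List.map_nil, List.flatten_nil,
      eastNorthPairs, Finset.range_zero, Finset.sum_empty]
    induction a with
    | nil => rfl
    | cons x a ih => simp [pairSum, ← ih]
  | succ J ih =>
    have key : eastNorthPairs (zetaTail (J + 1) a) = eastNorthPairs (zetaTail J a) +
        pairSum (fun x y => eastLeftTerm J x y + eastRightTerm J x y) a := by
      rw [zetaTail_succ, eastNorthPairs_append, eastNorthPairs_append, List.count_append,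
        count_east_sMinusR, count_east_sPlusL, count_north_sPlusL, count_north_zetaTail,
        eastNorthPairs_sMinusR, eastNorthPairs_sPlusL, add_mul, sum_mul_sum_eq_pairSum,
        sum_mul_sum_eq_pairSum, sum_mul_sum_eq_pairSum]
      have h1 : (a.map fun x : ℤ =>
          (if x = -(J : ℤ) - 1 then 1 else 0) * (if x = (J : ℤ) then 1 else 0)).sum = 0 := by
        rw [List.map_congr_left (g := fun _ => 0) fun x _ => by split_ifs <;> omega]
        simp
      have h2 : (a.map fun x : ℤ =>
          (if x = -(J : ℤ) - 1 then 1 else 0) * northWeight J x).sum = 0 := by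
        rw [List.map_congr_left (g := fun _ => 0)
          fun x _ => by simp only [northWeight]; split_ifs <;> omega]
        simp
      have h3 : (a.map fun x : ℤ =>
          (if x = (J : ℤ) + 1 then 1 else 0) * northWeight J x).sum = 0 := by
        rw [List.map_congr_left (g := fun _ => 0)
          fun x _ => by simp only [northWeight]; split_ifs <;> omega]
        simp
      rw [h1, h2, h3]
      have h4 : (fun x y => eastLeftTerm J x y + eastRightTerm J x y) = fun x y : ℤ =>
          ((if y = -(J : ℤ) - 1 then 1 else 0) * (if x = -(J : ℤ) then 1 else 0)) +
          ((if x = (J : ℤ) + 1 then 1 else 0) * (if y = (J : ℤ) then 1 else 0)) +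
          ((if x = -(J : ℤ) - 1 then 1 else 0) * (if y = (J : ℤ) then 1 else 0) +
            (if y = -(J : ℤ) - 1 then 1 else 0) * (if x = (J : ℤ) then 1 else 0)) +
          ((if x = -(J : ℤ) - 1 then 1 else 0) * northWeight J y +
            (if y = -(J : ℤ) - 1 then 1 else 0) * northWeight J x) +
          ((if x = (J : ℤ) + 1 then 1 else 0) * northWeight J y +
            (if y = (J : ℤ) + 1 then 1 else 0) * northWeight J x) := by
        funext x y
        simp only [eastLeftTerm, eastRightTerm]
        ring
      rw [h4]
      simp only [pairSum_add]
      ring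
    rw [key, ih, ← pairSum_add]
    congr 1
    funext x y
    rw [Finset.sum_range_succ]

/-- The contribution of two entries `x`, `y` of the type `C` area vector, with `x` to the left
of `y`, to the type `C` diagonal inversion statistic. -/
def dinvWeight (x y : ℤ) : ℕ :=
  (if y = x then 1 else 0) + (if y = x + 1 then 1 else 0) + (if y = -x then 1 else 0) +
    (if y = -x + 1 then 1 else 0)

lemma sum_eastLeftTerm {n : ℕ} {x : ℤ} (y : ℤ) (hx : x.natAbs ≤ n) (h0 : x ≠ 0) :
    ∑ j ∈ Finset.range (n + 1), eastLeftTerm j x y =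
      (if y = (x.natAbs : ℤ) - 1 then 1 else 0) + northWeight (x.natAbs - 1) y := by
  rw [Finset.sum_eq_single (x.natAbs - 1)]
  · have hc : ((x.natAbs - 1 : ℕ) : ℤ) = (x.natAbs : ℤ) - 1 := by omega
    simp only [eastLeftTerm, hc]
    rcases lt_or_gt_of_ne h0 with h | h
    · rw [if_neg (show ¬x = (x.natAbs : ℤ) - 1 + 1 by omega),
        if_pos (show x = -((x.natAbs : ℤ) - 1) - 1 by omega), zero_mul, one_mul, zero_add]
    · rw [if_pos (show x = (x.natAbs : ℤ) - 1 + 1 by omega),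
        if_neg (show ¬x = -((x.natAbs : ℤ) - 1) - 1 by omega), zero_mul, one_mul, add_zero]
  · intro j _ hj
    simp [eastLeftTerm, show ¬x = (j : ℤ) + 1 by omega, show ¬x = -(j : ℤ) - 1 by omega]
  · intro h
    simp only [Finset.mem_range] at h
    omega

lemma sum_eastRightTerm {n : ℕ} (x : ℤ) {y : ℤ} (hy : y.natAbs ≤ n) (h0 : y ≠ 0) :
    ∑ j ∈ Finset.range (n + 1), eastRightTerm j x y =
      (if y < 0 then (if x = y + 1 then 1 else 0) + (if x = -y - 1 then 1 else 0) else 0) +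
        northWeight (y.natAbs - 1) x := by
  rw [Finset.sum_eq_single (y.natAbs - 1)]
  · simp only [eastRightTerm]
    rcases lt_or_gt_of_ne h0 with h | h
    · have hc : ((y.natAbs - 1 : ℕ) : ℤ) = -y - 1 := by omega
      rw [hc, if_neg (show ¬y = -y - 1 + 1 by omega), if_pos (show y = -(-y - 1) - 1 by omega),
        if_pos h, zero_mul, one_mul, zero_add, show -(-y - 1) = y + 1 by ring]
    · have hc : ((y.natAbs - 1 : ℕ) : ℤ) = y - 1 := by omega
      rw [hc, if_pos (show y = y - 1 + 1 by omega), if_neg (show ¬y = -(y - 1) - 1 by omega),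
        if_neg (show ¬y < 0 by omega), zero_mul, one_mul, add_zero, zero_add]
  · intro j _ hj
    rw [eastRightTerm, if_neg (show ¬y = (j : ℤ) + 1 by omega),
      if_neg (show ¬y = -(j : ℤ) - 1 by omega), zero_mul, zero_mul, add_zero]
  · intro h
    simp only [Finset.mem_range] at h
    omega

lemma sum_terms_add_dinvWeight {n : ℕ} {x y : ℤ} (hx : x.natAbs ≤ n) (hy : y.natAbs ≤ n) :
    ∑ j ∈ Finset.range (n + 1), (eastLeftTerm j x y + eastRightTerm j x y) + dinvWeight x y =
      1 + if x = 0 ∨ y = 0 then 1 else 0 := by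
  have hl : x = 0 → ∑ j ∈ Finset.range (n + 1), eastLeftTerm j x y = 0 := by
    intro h
    refine Finset.sum_eq_zero fun j _ => ?_
    simp [eastLeftTerm, show ¬x = (j : ℤ) + 1 by omega, show ¬x = -(j : ℤ) - 1 by omega]
  have hr : y = 0 → ∑ j ∈ Finset.range (n + 1), eastRightTerm j x y = 0 := by
    intro h
    refine Finset.sum_eq_zero fun j _ => ?_
    rw [eastRightTerm, if_neg (show ¬y = (j : ℤ) + 1 by omega),
      if_neg (show ¬y = -(j : ℤ) - 1 by omega), zero_mul, zero_mul, add_zero]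
  rw [Finset.sum_add_distrib]
  rcases eq_or_ne x 0 with h | h <;> rcases eq_or_ne y 0 with h' | h'
  · rw [hl h, hr h']
    simp [dinvWeight, h, h']
  · rw [hl h, sum_eastRightTerm x hy h', if_pos (Or.inl h), h]
    clear hl hr hx hy h
    simp only [northWeight, dinvWeight]
    rcases lt_or_gt_of_ne h' with h' | h'
    · rw [if_pos h', show ((y.natAbs - 1 : ℕ) : ℤ) = -y - 1 by omega]
      split_ifs <;> omega
    · rw [if_neg (show ¬y < 0 by omega), show ((y.natAbs - 1 : ℕ) : ℤ) = y - 1 by omega]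
      split_ifs <;> omega
  · rw [hr h', sum_eastLeftTerm y hx h, if_pos (Or.inr h'), h']
    clear hl hr hx hy h'
    simp only [northWeight, dinvWeight]
    split_ifs <;> omega
  · rw [sum_eastLeftTerm y hx h, sum_eastRightTerm x hy h',
      if_neg (show ¬(x = 0 ∨ y = 0) by tauto)]
    clear hl hr hx hy
    simp only [northWeight, dinvWeight]
    rcases lt_or_gt_of_ne h with h | h <;> rcases lt_or_gt_of_ne h' with h' | h'
    · rcases (show y ≤ x - 2 ∨ y = x - 1 ∨ y = x ∨ y = x + 1 ∨ x + 2 ≤ y by omega) with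
        hd | hd | hd | hd | hd <;> simp (disch := omega) only [if_pos, if_neg]
    · rcases (show y ≤ -x - 2 ∨ y = -x - 1 ∨ y = -x ∨ y = -x + 1 ∨ -x + 2 ≤ y by omega) with
        hd | hd | hd | hd | hd <;> simp (disch := omega) only [if_pos, if_neg]
    · rcases (show y ≤ -x - 2 ∨ y = -x - 1 ∨ y = -x ∨ y = -x + 1 ∨ -x + 2 ≤ y by omega) with
        hd | hd | hd | hd | hd <;> simp (disch := omega) only [if_pos, if_neg]
    · rcases (show y ≤ x - 2 ∨ y = x - 1 ∨ y = x ∨ y = x + 1 ∨ x + 2 ≤ y by omega) with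
        hd | hd | hd | hd | hd <;> simp (disch := omega) only [if_pos, if_neg]

lemma pairSum_zero_weight (a : List ℤ) :
    2 * pairSum (fun x y => 1 + if x = 0 ∨ y = 0 then 1 else 0) a + 2 * a.count 0 +
      (a.length - a.count 0) * (a.length - a.count 0 + 1) = 2 * a.length ^ 2 := by
  induction a with
  | nil => simp [pairSum]
  | cons x a ih =>
    obtain ⟨q, hq⟩ := Nat.exists_eq_add_of_le (List.count_le_length (a := (0 : ℤ)) (l := a))
    rw [hq] at ih
    simp only [add_tsub_cancel_left] at ih
    rcases eq_or_ne x 0 with rfl | h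
    · simp only [pairSum, true_or, if_true, List.map_const', List.sum_replicate, List.count_cons_self,
        List.length_cons, hq]
      rw [show a.count 0 + q + 1 - (a.count 0 + 1) = q by omega, smul_eq_mul]
      linarith
    · have h1 : (a.map fun y => 1 + if x = 0 ∨ y = 0 then 1 else 0).sum
          = a.length + a.count 0 := by
        clear ih hq
        induction a with
        | nil => simp
        | cons z a ih => by_cases hz : z = 0 <;> simp_all <;> omega
      simp only [pairSum]
      rw [h1, List.count_cons_of_ne h, List.length_cons, hq,
        show a.count 0 + q + 1 - a.count 0 = q + 1 by omega]
      linarith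

lemma count_east_zetaTail_of_bounded {n : ℕ} {a : List ℤ} (ha : ∀ x ∈ a, x.natAbs ≤ n) :
    (zetaTail (n + 1) a).count Step.E = a.length - a.count 0 := by
  rw [count_east_zetaTail]
  have h : (a.map (eastWeight (n + 1))).sum + a.count 0 = a.length := by
    induction a with
    | nil => simp
    | cons x a ih =>
      have := ih fun y hy => ha y (by simp [hy])
      have hx := ha x (by simp)
      simp only [List.map_cons, List.sum_cons, List.length_cons, List.count_cons, eastWeight,
        beq_iff_eq]
      rcases eq_or_ne x 0 with h | h
      · rw [if_neg (by tauto), if_pos h]; omega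
      · rw [if_pos (by push_cast; exact ⟨h, by omega, by omega⟩), if_neg h]; omega
  omega

lemma length_zetaTail_of_bounded {n : ℕ} {a : List ℤ} (ha : ∀ x ∈ a, x.natAbs ≤ n) :
    (zetaTail (n + 1) a).length = 2 * a.length := by
  rw [← count_east_add_count_north, count_east_zetaTail, count_north_zetaTail,
    ← sum_map_add_nat, List.map_congr_left (g := fun _ => 2)]
  · simp [mul_comm]
  · intro x hx
    have := ha x hx
    simp only [eastWeight, northWeight]
    push_cast
    split_ifs <;> omega

/-- Every prefix of `zetaTail J a` has at least as many North steps as East steps, up to the East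
steps coming from the entries `±J`. -/
lemma count_take_zetaTail (J : ℕ) (a : List ℤ) (k : ℕ) :
    ((zetaTail J a).take k).count Step.E ≤ ((zetaTail J a).take k).count Step.N +
      (a.map fun x => if x.natAbs = J then 1 else 0).sum := by
  induction J generalizing k with
  | zero => simp [zetaTail]
  | succ J ih =>
    have hE : (sMinusR J a ++ sPlusL J a).count Step.E =
        (a.map fun x => if x.natAbs = J + 1 then 1 else 0).sum := by
      rw [List.count_append, count_east_sMinusR, count_east_sPlusL, ← sum_map_add_nat]
      congr 1
      refine List.map_congr_left fun x _ => ?_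
      split_ifs <;> omega
    have hN : (a.map fun x => if x.natAbs = J then 1 else 0).sum ≤
        (sMinusR J a ++ sPlusL J a).count Step.N := by
      rw [List.count_append, count_north_sMinusR, count_north_sPlusL, ← sum_map_add_nat]
      refine List.sum_le_sum fun x _ => ?_
      split_ifs <;> omega
    rw [zetaTail_succ, List.take_append, List.count_append, List.count_append]
    rcases le_total k (sMinusR J a ++ sPlusL J a).length with h | h
    · have := (List.take_sublist k (sMinusR J a ++ sPlusL J a)).count_le Step.E
      rw [Nat.sub_eq_zero_of_le h]
      simp only [List.take_zero, List.count_nil]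
      omega
    · rw [List.take_of_length_le h]
      have := ih (k - (sMinusR J a ++ sPlusL J a).length)
      omega

lemma count_take_zetaTail_of_bounded {n : ℕ} {a : List ℤ} (ha : ∀ x ∈ a, x.natAbs ≤ n) (k : ℕ) :
    ((zetaTail (n + 1) a).take k).count Step.E ≤ ((zetaTail (n + 1) a).take k).count Step.N := by
  refine (count_take_zetaTail (n + 1) a k).trans_eq ?_
  rw [List.map_congr_left (g := fun _ => 0)]
  · simp
  · intro x hx
    have := ha x hx
    rw [if_neg (by omega)]


/-! ### Valleys and roots -/

lemma le_ebn_iff (β : List Step) (i j : ℕ) (hj : 1 ≤ j) :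
    i ≤ ebn β j ↔ ∃ k, i ≤ (β.take k).count Step.E ∧ (β.take k).count Step.N < j := by
  obtain ⟨j, rfl⟩ := Nat.exists_eq_add_of_le' hj
  induction β generalizing i j with
  | nil => simp [ebn]
  | cons s β ih =>
    cases s
    · rcases j with _ | j
      · simp only [ebn, Nat.le_zero, zero_add]
        constructor
        · rintro rfl
          exact ⟨0, by simp⟩
        · rintro ⟨_ | k, h1, h2⟩
          · simpa using h1
          · simp at h2
      · rw [ebn, ih i j (by omega)]
        constructor
        · rintro ⟨k, h1, h2⟩
          exact ⟨k + 1, by simpa using h1, by simpa using h2⟩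
        · rintro ⟨_ | k, h1, h2⟩
          · exact ⟨0, by simpa using h1, by simp⟩
          · exact ⟨k, by simpa using h1, by simpa using h2⟩
    · rw [ebn]
      rcases i with _ | i
      · exact iff_of_true (by simp) ⟨0, by simp⟩
      · rw [Nat.add_le_add_iff_right, ih i j (by omega)]
        constructor
        · rintro ⟨k, h1, h2⟩
          exact ⟨k + 1, by simpa using h1, by simpa using h2⟩
        · rintro ⟨_ | k, h1, h2⟩
          · simp at h1
          · exact ⟨k, by simpa using h1, by simpa using h2⟩

lemma count_take_succ {β : List Step} {p : ℕ} {s : Step} (h : β[p]? = some s) (t : Step) :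
    (β.take (p + 1)).count t = (β.take p).count t + if s = t then 1 else 0 := by
  rw [List.take_add_one, h, Option.toList_some, List.count_append, List.count_singleton]
  simp [beq_iff_eq]

lemma IsValley.exists_take {β : List Step} {a b : ℕ} (h : IsValley β a b) :
    1 ≤ a ∧ ∃ k, (β.take k).count Step.E = a ∧ (β.take k).count Step.N + 1 = b := by
  rcases h with ⟨p, h1, _, h3, h4⟩ | ⟨h1, h2, h3⟩
  · refine ⟨by omega, p + 1, ?_, h4⟩
    rw [count_take_succ h1, if_pos rfl, h3]
  · refine ⟨?_, β.length, by simp [h2], by simp [h3]⟩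
    rw [h2]
    exact List.count_pos_iff.2 (List.mem_of_getLast? h1)

lemma exists_isValley_of_getElem?_eq_east {β : List Step} {p : ℕ} (h : β[p]? = some Step.E) :
    ∃ a b, IsValley β a b ∧ (β.take (p + 1)).count Step.E ≤ a ∧
      b ≤ (β.take (p + 1)).count Step.N + 1 := by
  induction hd : β.length - p generalizing p with
  | zero =>
    rw [List.getElem?_eq_none (by omega)] at h
    simp at h
  | succ d ih =>
    rcases hs : β[p + 1]? with _ | s
    · refine ⟨_, _, Or.inr ⟨?_, rfl, rfl⟩, (List.take_sublist _ _).count_le _, ?_⟩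
      · have := List.getElem?_eq_none_iff.1 hs
        rw [List.getLast?_eq_getElem?, show β.length - 1 = p by omega, h]
      · rw [List.take_of_length_le (List.getElem?_eq_none_iff.1 hs)]
    · cases s
      · refine ⟨_, _, Or.inl ⟨p, h, hs, rfl, rfl⟩, ?_, le_rfl⟩
        rw [count_take_succ h, if_pos rfl]
      · obtain ⟨a, b, hv, h1, h2⟩ := ih hs (by omega)
        rw [count_take_succ hs, if_pos rfl] at h1
        rw [count_take_succ hs, if_neg (by simp)] at h2
        exact ⟨a, b, hv, by omega, h2⟩

lemma exists_isValley_iff {β : List Step} {i j : ℕ} (hi : 1 ≤ i) (hj : 1 ≤ j) :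
    (∃ a b, IsValley β a b ∧ i ≤ a ∧ b ≤ j) ↔ i ≤ ebn β j := by
  rw [le_ebn_iff β i j hj]
  constructor
  · rintro ⟨a, b, h, h1, h2⟩
    obtain ⟨_, k, h3, h4⟩ := h.exists_take
    exact ⟨k, by omega, by omega⟩
  · intro h
    classical
    obtain ⟨h1, h2⟩ := Nat.find_spec h
    rcases hk : Nat.find h with _ | k
    · rw [hk] at h1
      simp at h1
      omega
    rw [hk] at h1 h2
    have hmin := Nat.find_min h (show k < Nat.find h by omega)
    rcases hs : β[k]? with _ | s
    · have := List.getElem?_eq_none_iff.1 hs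
      rw [List.take_of_length_le (by omega)] at h1 h2 hmin
      exact absurd ⟨h1, h2⟩ hmin
    · cases s
      · rw [count_take_succ hs] at h1 h2
        simp at h1
        exact absurd ⟨h1, by omega⟩ hmin
      · obtain ⟨a, b, hv, h3, h4⟩ := exists_isValley_of_getElem?_eq_east hs
        exact ⟨a, b, hv, by omega, by omega⟩

/-- The vectors `f₁, …, f₂ₙ` with `fᵢ = e_{n+1-i}` for `i ≤ n` and `fᵢ = -e_{i-n}` for `i > n`;
their differences are the roots of type `C`. -/
def signedBasis (n i : ℕ) : Fin n → ℤ := if i ≤ n then eI n (n + 1 - i) else -eI n (i - n)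

lemma rootOfValleyC_eq_sub {n i : ℕ} (hi : i ≤ n) (j : ℕ) :
    rootOfValleyC n i j = signedBasis n i - signedBasis n j := by
  by_cases hj : j ≤ n <;> simp [rootOfValleyC, signedBasis, hi, hj]

lemma rootOfValleyC_mem_posRootsC {n i j : ℕ} (hi : 1 ≤ i) (hij : i < j) (hs : i + j ≤ 2 * n + 1) :
    rootOfValleyC n i j ∈ PosRootsC n := by
  rw [rootOfValleyC]
  split_ifs with hj
  · exact Or.inl ⟨n + 1 - j, n + 1 - i, by omega, by omega, by omega, Or.inl rfl⟩
  · rcases (show j - n < n + 1 - i ∨ j - n = n + 1 - i by omega) with h | h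
    · exact Or.inl ⟨j - n, n + 1 - i, by omega, h, by omega, Or.inr rfl⟩
    · exact Or.inr ⟨j - n, by omega, by omega, by rw [h, two_smul]⟩

lemma exists_rootOfValleyC_eq {n : ℕ} {x : Fin n → ℤ} (hx : x ∈ PosRootsC n) :
    ∃ i j, 1 ≤ i ∧ i < j ∧ i + j ≤ 2 * n + 1 ∧ rootOfValleyC n i j = x := by
  rcases hx with ⟨i, j, hi, hij, hj, rfl | rfl⟩ | ⟨i, hi, hin, rfl⟩
  · refine ⟨n + 1 - j, n + 1 - i, by omega, by omega, by omega, ?_⟩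
    rw [rootOfValleyC, if_pos (by omega), show n + 1 - (n + 1 - j) = j by omega,
      show n + 1 - (n + 1 - i) = i by omega]
  · refine ⟨n + 1 - j, n + i, by omega, by omega, by omega, ?_⟩
    rw [rootOfValleyC, if_neg (by omega), show n + 1 - (n + 1 - j) = j by omega,
      show n + i - n = i by omega]
  · refine ⟨n + 1 - i, n + i, by omega, by omega, by omega, ?_⟩
    rw [rootOfValleyC, if_neg (by omega), show n + 1 - (n + 1 - i) = i by omega,
      show n + i - n = i by omega, two_smul]

lemma signedBasis_sub_mem {n i j : ℕ} (hi : 1 ≤ i) (hij : i ≤ j) (hj : j ≤ 2 * n) :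
    signedBasis n i - signedBasis n j ∈ AddSubmonoid.closure (PosRootsC n) := by
  rcases hij.eq_or_lt with rfl | hij
  · simp
  refine AddSubmonoid.subset_closure ?_
  rcases le_or_gt i n with h | h
  · rcases le_or_gt (i + j) (2 * n + 1) with h' | h'
    · rw [← rootOfValleyC_eq_sub h]
      exact rootOfValleyC_mem_posRootsC hi hij h'
    · rw [signedBasis, signedBasis, if_pos h, if_neg (by omega), sub_neg_eq_add, add_comm]
      exact Or.inl ⟨n + 1 - i, j - n, by omega, by omega, by omega, Or.inr rfl⟩
  · rw [signedBasis, signedBasis, if_neg (by omega), if_neg (by omega)]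
    exact Or.inl ⟨i - n, j - n, by omega, by omega, by omega, Or.inl (by abel)⟩

/-- The sum of the last `c` coordinates of an integer vector. -/
def topSum (n c : ℕ) : (Fin n → ℤ) →+ ℤ where
  toFun x := ∑ t : Fin n, if n < t.val + 1 + c then x t else 0
  map_zero' := by simp
  map_add' x y := by
    rw [← Finset.sum_add_distrib]
    refine Finset.sum_congr rfl fun t _ => ?_
    split_ifs <;> simp

lemma topSum_eI {n c k : ℕ} (hk : 1 ≤ k) (hkn : k ≤ n) :
    topSum n c (eI n k) = if n < k + c then 1 else 0 := by
  change (∑ t : Fin n, if n < t.val + 1 + c then eI n k t else 0) = _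
  rw [Finset.sum_eq_single (⟨k - 1, by omega⟩ : Fin n)]
  · simp only [eI, show k - 1 + 1 = k by omega, if_true]
  · intro t _ ht
    have : t.val + 1 ≠ k := fun h => ht (Fin.ext (by simp; omega))
    simp [eI, this]
  · simp

lemma topSum_nonneg {n c : ℕ} {x : Fin n → ℤ} (hx : x ∈ AddSubmonoid.closure (PosRootsC n)) :
    0 ≤ topSum n c x := by
  induction hx using AddSubmonoid.closure_induction with
  | mem x hx =>
    rcases hx with ⟨i, j, hi, hij, hj, rfl | rfl⟩ | ⟨i, hi, hin, rfl⟩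
    · rw [map_sub, topSum_eI (by omega) hj, topSum_eI hi (by omega)]
      split_ifs <;> omega
    · rw [map_add, topSum_eI (by omega) hj, topSum_eI hi (by omega)]
      split_ifs <;> omega
    · rw [map_zsmul, topSum_eI hi hin]
      split_ifs <;> simp
  | zero => simp
  | add x y _ _ hx hy => rw [map_add]; omega

lemma topSum_rootOfValleyC {n c i j : ℕ} (hi : 1 ≤ i) (hij : i < j) (hs : i + j ≤ 2 * n + 1) :
    topSum n c (rootOfValleyC n i j) = (if i ≤ c then 1 else 0) +
      if j ≤ n then (if j ≤ c then -1 else 0) else (if 2 * n + 1 ≤ j + c then 1 else 0) := by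
  rw [rootOfValleyC]
  split_ifs with hj
  all_goals first
    | rw [map_sub, topSum_eI (by omega) (by omega), topSum_eI (by omega) (by omega)]
      split_ifs <;> omega
    | rw [map_add, topSum_eI (by omega) (by omega), topSum_eI (by omega) (by omega)]
      split_ifs <;> omega

lemma rootLE_rootOfValleyC_iff {n a b i j : ℕ} (ha : 1 ≤ a) (hab : a < b)
    (hs : a + b ≤ 2 * n + 1) (hi : 1 ≤ i) (hij : i < j) (hs' : i + j ≤ 2 * n + 1) :
    rootLE n (rootOfValleyC n a b) (rootOfValleyC n i j) ↔ i ≤ a ∧ b ≤ j := by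
  rw [rootLE]
  constructor
  · intro h
    have key : ∀ c, topSum n c (rootOfValleyC n a b) ≤ topSum n c (rootOfValleyC n i j) := by
      intro c
      have := topSum_nonneg (c := c) h
      rw [map_sub] at this
      omega
    simp only [topSum_rootOfValleyC ha hab hs, topSum_rootOfValleyC hi hij hs'] at key
    have h1 : i ≤ a := by
      have := key a
      split_ifs at this <;> omega
    refine ⟨h1, ?_⟩
    by_contra! hb
    have h2 := key j
    have h3 := key (2 * n + 1 - b)
    have h4 := key a
    split_ifs at h4 <;> omega
  · rintro ⟨h1, h2⟩
    rw [rootOfValleyC_eq_sub (by omega), rootOfValleyC_eq_sub (by omega),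
      show signedBasis n i - signedBasis n j - (signedBasis n a - signedBasis n b) =
        (signedBasis n i - signedBasis n a) + (signedBasis n b - signedBasis n j) by abel]
    exact add_mem (signedBasis_sub_mem hi h1 (by omega))
      (signedBasis_sub_mem (by omega) h2 (by omega))

lemma rootOfValleyC_injective {n a b i j : ℕ} (ha : 1 ≤ a) (hab : a < b)
    (hs : a + b ≤ 2 * n + 1) (hi : 1 ≤ i) (hij : i < j) (hs' : i + j ≤ 2 * n + 1)
    (h : rootOfValleyC n a b = rootOfValleyC n i j) : a = i ∧ b = j := by
  have h1 := (rootLE_rootOfValleyC_iff ha hab hs hi hij hs').1 (by simp [rootLE, h])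
  have h2 := (rootLE_rootOfValleyC_iff hi hij hs' ha hab hs).1 (by simp [rootLE, h])
  omega

lemma IsBallotPath.valley_bounds {n : ℕ} {β : List Step} (hβ : IsBallotPath (2 * n) β) {a b : ℕ}
    (h : IsValley β a b) : 1 ≤ a ∧ a < b ∧ a + b ≤ 2 * n + 1 := by
  obtain ⟨h1, k, h2, h3⟩ := h.exists_take
  have h4 := hβ.2 k
  have h5 := count_east_add_count_north (β.take k)
  have h6 := List.length_take_le' k β
  have h7 := hβ.1
  omega

lemma IsBallotPath.ebn_lt {m : ℕ} {β : List Step} (hβ : IsBallotPath m β) {j : ℕ} (hj : 1 ≤ j) :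
    ebn β j < j := by
  obtain ⟨k, h1, h2⟩ := (le_ebn_iff β (ebn β j) j hj).1 le_rfl
  have := hβ.2 k
  omega

lemma IsBallotPath.idealC_eq {n : ℕ} {β : List Step} (hβ : IsBallotPath (2 * n) β) :
    idealC n β = (fun p : (_ : ℕ) × ℕ => rootOfValleyC n p.2 (p.1 + 1)) ''
      ((Finset.range (2 * n)).sigma
        fun j => Finset.Ioc (ebn β (j + 1)) (min j (2 * n - j)) : Finset ((_ : ℕ) × ℕ)) := by
  have key : ∀ i j, 1 ≤ i → i < j → i + j ≤ 2 * n + 1 →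
      ((∃ y ∈ antichainC n β, rootLE n y (rootOfValleyC n i j)) ↔ i ≤ ebn β j) := by
    intro i j hi hij hs
    rw [← exists_isValley_iff hi (by omega)]
    constructor
    · rintro ⟨_, ⟨a, b, hv, rfl⟩, hle⟩
      obtain ⟨h1, h2, h3⟩ := hβ.valley_bounds hv
      exact ⟨a, b, hv, (rootLE_rootOfValleyC_iff h1 h2 h3 hi hij hs).1 hle⟩
    · rintro ⟨a, b, hv, hle⟩
      obtain ⟨h1, h2, h3⟩ := hβ.valley_bounds hv
      exact ⟨_, ⟨a, b, hv, rfl⟩, (rootLE_rootOfValleyC_iff h1 h2 h3 hi hij hs).2 hle⟩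
  ext x
  simp only [idealC, Set.mem_ofPred_eq, Set.mem_image, Finset.mem_coe, Finset.mem_sigma,
    Finset.mem_range, Finset.mem_Ioc]
  constructor
  · rintro ⟨hx, hn⟩
    obtain ⟨i, j, hi, hij, hs, rfl⟩ := exists_rootOfValleyC_eq hx
    rw [key i j hi hij hs] at hn
    refine ⟨⟨j - 1, i⟩, ?_, ?_⟩
    · simp only [show j - 1 + 1 = j by omega]
      omega
    · simp only [show j - 1 + 1 = j by omega]
  · rintro ⟨⟨j, i⟩, h, rfl⟩
    simp only at h ⊢
    refine ⟨rootOfValleyC_mem_posRootsC (by omega) (by omega) (by omega), ?_⟩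
    rw [key i (j + 1) (by omega) (by omega) (by omega)]
    omega

lemma IsBallotPath.areaStatC_eq {n : ℕ} {β : List Step} (hβ : IsBallotPath (2 * n) β) :
    areaStatC n β =
      ∑ j ∈ Finset.range (2 * n), (min j (2 * n - j) - ebn β (j + 1)) := by
  rw [areaStatC, hβ.idealC_eq, Set.InjOn.ncard_image, Set.ncard_coe_finset, Finset.card_sigma]
  · simp
  · rintro ⟨j, i⟩ h ⟨b, a⟩ h' heq
    simp only [Finset.mem_coe, Finset.mem_sigma, Finset.mem_range, Finset.mem_Ioc] at h h' heq
    obtain ⟨rfl, h2⟩ : i = a ∧ j + 1 = b + 1 := rootOfValleyC_injective (by omega) (by omega) (by omega) (by omega)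
      (by omega) (by omega) heq
    obtain rfl : j = b := by omega
    rfl

lemma sum_ebn (β : List Step) :
    ∑ j ∈ Finset.range (β.count Step.N), ebn β (j + 1) = eastNorthPairs β := by
  induction β with
  | nil => simp [eastNorthPairs]
  | cons s β ih =>
    cases s
    · rw [List.count_cons_self, Finset.sum_range_succ']
      simp [ebn, ih, eastNorthPairs]
    · rw [List.count_cons_of_ne (by simp)]
      simp [ebn, eastNorthPairs, Finset.sum_add_distrib, ih]

lemma ebn_add_le {β : List Step} {j : ℕ} (hj : 1 ≤ j) (hjN : j ≤ β.count Step.N) :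
    ebn β j + j ≤ β.length := by
  obtain ⟨k, h1, h2⟩ := (le_ebn_iff β (ebn β j) j hj).1 le_rfl
  have h3 := count_east_add_count_north β
  have h4 := (List.take_sublist k β).count_le Step.E
  omega

lemma ebn_of_count_lt {β : List Step} {j : ℕ} (hj : β.count Step.N < j) :
    ebn β j = β.count Step.E := by
  refine le_antisymm ?_ ((le_ebn_iff β _ j (by omega)).2 ⟨β.length, by simp, by simpa using hj⟩)
  obtain ⟨k, h1, h2⟩ := (le_ebn_iff β (ebn β j) j (by omega)).1 le_rfl
  exact h1.trans ((List.take_sublist k β).count_le _)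

lemma two_mul_sum_range_sub (q : ℕ) : 2 * ∑ k ∈ Finset.range q, (q - k) = q * (q + 1) := by
  induction q with
  | zero => simp
  | succ q ih =>
    rw [Finset.sum_range_succ']
    simp only [Nat.add_sub_add_right, Nat.sub_zero]
    linarith

lemma IsBallotPath.areaStatC_add {n : ℕ} {β : List Step} (hβ : IsBallotPath (2 * n) β) :
    2 * areaStatC n β + 2 * eastNorthPairs β + β.count Step.E * (β.count Step.E + 1) =
      2 * n ^ 2 := by
  have hlen := count_east_add_count_north β
  rw [hβ.1] at hlen
  have h1 : ∑ j ∈ Finset.range (2 * n), min (ebn β (j + 1)) (2 * n - j) =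
      eastNorthPairs β + ∑ k ∈ Finset.range (β.count Step.E), (β.count Step.E - k) := by
    rw [show 2 * n = β.count Step.N + β.count Step.E by omega, Finset.sum_range_add, ← sum_ebn]
    congr 1
    · refine Finset.sum_congr rfl fun j hj => min_eq_left ?_
      have := ebn_add_le (β := β) (j := j + 1) (by omega) (Finset.mem_range.1 hj)
      rw [hβ.1] at this
      omega
    · refine Finset.sum_congr rfl fun k hk => ?_
      rw [ebn_of_count_lt (by omega)]
      omega
  have h2 : ∑ j ∈ Finset.range (2 * n), min j (2 * n - j) =
      ∑ j ∈ Finset.range n, j + ∑ k ∈ Finset.range n, (n - k) := by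
    rw [two_mul, Finset.sum_range_add]
    congr 1 <;> refine Finset.sum_congr rfl fun j hj => ?_ <;> rw [Finset.mem_range] at hj <;> omega
  have h3 : areaStatC n β + ∑ j ∈ Finset.range (2 * n), min (ebn β (j + 1)) (2 * n - j) =
      ∑ j ∈ Finset.range (2 * n), min j (2 * n - j) := by
    rw [hβ.areaStatC_eq, ← Finset.sum_add_distrib]
    refine Finset.sum_congr rfl fun j _ => ?_
    have := hβ.ebn_lt (j := j + 1) (by omega)
    omega
  have h4 := two_mul_sum_range_sub (β.count Step.E)
  have h5 : ∑ j ∈ Finset.range n, j + ∑ k ∈ Finset.range n, (n - k) = n ^ 2 := by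
    rw [← Finset.sum_add_distrib, Finset.sum_congr rfl (g := fun _ => n)
      fun j hj => by rw [Finset.mem_range] at hj; omega]
    simp [sq]
  linarith

/-! ### The diagonal inversion statistic -/

lemma ebn_le_count (β : List Step) (j : ℕ) : ebn β j ≤ β.count Step.E := by
  rcases Nat.eq_zero_or_pos j with rfl | hj
  · cases β <;> simp [ebn]
  · obtain ⟨k, h1, _⟩ := (le_ebn_iff β (ebn β j) j hj).1 le_rfl
    exact h1.trans ((List.take_sublist k β).count_le _)

lemma natAbs_le_of_mem_areaCList {n : ℕ} {π : List Step} (hπ : π.count Step.E = n) :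
    ∀ x ∈ areaCList n π, x.natAbs ≤ n := by
  intro x hx
  simp only [areaCList, List.mem_map, List.mem_range] at hx
  obtain ⟨k, hk, rfl⟩ := hx
  have := ebn_le_count π (n + 1 - (k + 1))
  simp only [areaC]
  omega

lemma pairSum_map_range {α : Type*} (f : α → α → ℕ) (g : ℕ → α) (n : ℕ) :
    pairSum f ((List.range n).map g) =
      ∑ j ∈ Finset.range n, ∑ i ∈ Finset.range j, f (g i) (g j) := by
  induction n with
  | zero => simp [pairSum]
  | succ n ih =>
    rw [List.range_succ, List.map_append, List.map_singleton, pairSum_concat, ih,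
      Finset.sum_range_succ, List.map_map]
    congr 1

lemma card_filter_lt_eq_pairSum {α : Type*} (n : ℕ) (g : ℕ → α) (P : α → α → Prop)
    [∀ x y, Decidable (P x y)] :
    (Finset.univ.filter fun p : Fin n × Fin n =>
      p.1 < p.2 ∧ P (g (n - p.1.val)) (g (n - p.2.val))).card =
      pairSum (fun x y => if P y x then 1 else 0) ((List.range n).map fun k => g (k + 1)) := by
  rw [pairSum_map_range, Finset.card_filter, Fintype.sum_prod_type,
    ← Equiv.sum_comp Fin.revPerm, Finset.sum_range]
  refine Finset.sum_congr rfl fun j _ => ?_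
  rw [← Equiv.sum_comp Fin.revPerm]
  simp only [Fin.revPerm_apply, Fin.rev_lt_rev, Fin.val_rev]
  have h (i : Fin n) : n - (n - (i.val + 1)) = i.val + 1 := by omega
  simp only [h, Fin.lt_def]
  rw [Fin.sum_univ_eq_sum_range
    (fun i => if i < j.val ∧ P (g (j.val + 1)) (g (i + 1)) then 1 else 0)]
  rw [← Finset.sum_subset (Finset.range_subset_range.2 j.isLt.le)]
  · exact Finset.sum_congr rfl fun i hi => by simp [Finset.mem_range.1 hi]
  · intro i _ hi
    simp [mt Finset.mem_range.2 hi]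

lemma count_map_range {α : Type*} [DecidableEq α] (f : ℕ → α) (a : α) (n : ℕ) :
    ((List.range n).map f).count a = ∑ i ∈ Finset.range n, if f i = a then 1 else 0 := by
  induction n with
  | zero => simp
  | succ n ih =>
    rw [List.range_succ, List.map_append, List.count_append, ih, Finset.sum_range_succ]
    congr 1
    simp [List.count_singleton]

lemma dinvC_eq_pairSum (n : ℕ) (π : List Step) :
    dinvC n π = pairSum dinvWeight (areaCList n π) + (areaCList n π).count 0 := by
  have h := card_filter_lt_eq_pairSum n (areaC n π)
  have h0 : (Finset.univ.filter fun i : Fin n => areaC n π (n - i.val) = 0).card =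
      (areaCList n π).count 0 := by
    rw [Finset.card_filter, ← Equiv.sum_comp Fin.revPerm, areaCList]
    simp only [Fin.revPerm_apply, Fin.val_rev]
    have h1 (i : Fin n) : n - (n - (i.val + 1)) = i.val + 1 := by omega
    simp only [h1]
    rw [count_map_range, ← Fin.sum_univ_eq_sum_range]
  rw [dinvC, h fun x y => x = y, h fun x y => x = y + 1, h fun x y => x = -y,
    h fun x y => x = -y + 1, h0, ← pairSum_add, ← pairSum_add, ← pairSum_add]
  rfl

/-- For every `n ≥ 1` and every lattice path `π ∈ L_{n,n}`,
`dinv_C(π) = area(ζ_C(π))`. -/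
theorem dinvC_eq_area_zetaC (n : ℕ) (hn : 1 ≤ n) (π : List Step)
    (hπ : IsLatticePath n n π) :
    dinvC n π = areaStatC n (zetaC n π) := by
  have ha := natAbs_le_of_mem_areaCList hπ.1
  have hlen : (areaCList n π).length = n := by simp [areaCList]
  have hζ : zetaC n π = zetaTail (n + 1) (areaCList n π) := by
    simp [zetaC, zetaTail, List.bind_eq_flatMap, List.map_eq_flatMap, List.flatMap_assoc]
  have hβ : IsBallotPath (2 * n) (zetaC n π) := by
    rw [hζ]
    refine ⟨?_, count_take_zetaTail_of_bounded ha⟩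
    rw [length_zetaTail_of_bounded ha, hlen]
  have h1 := hβ.areaStatC_add
  have h2 := pairSum_zero_weight (areaCList n π)
  have h3 : eastNorthPairs (zetaC n π) + pairSum dinvWeight (areaCList n π) =
      pairSum (fun x y => 1 + if x = 0 ∨ y = 0 then 1 else 0) (areaCList n π) := by
    rw [hζ, eastNorthPairs_zetaTail, ← pairSum_add]
    exact pairSum_congr fun x hx y hy => sum_terms_add_dinvWeight (ha x hx) (ha y hy)
  rw [hζ, count_east_zetaTail_of_bounded ha, ← hζ, hlen] at h1
  rw [hlen] at h2
  rw [dinvC_eq_pairSum]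
  linarith
end

section
/- For every n ≥ 1, the map ψ : Vert(C_n) → ℤ^n/(2n+1)ℤ^n sending (π,u) to the residue class of u·λ(π) modulo (2n+1)ℤ^n, where λ(π) ∈ ℤ^n has k-th entry the number of East steps of π preceding its k-th North step, is a bijection. -/
/-- `w` is the window `[w(1),…,w(n)]` of a signed permutation of rank `n`. -/
def IsSignedPerm (n : ℕ) (w : Fin n → ℤ) : Prop :=
  (∀ i, 1 ≤ |w i| ∧ |w i| ≤ (n : ℤ)) ∧ Function.Injective fun i => |w i|

/-- Evaluation of (the window of) a signed permutation at any integer, via `w(-j) = -w(j)`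
and `w(0) = 0`. -/
def evalSP {n : ℕ} (w : Fin n → ℤ) (j : ℤ) : ℤ :=
  if h : 1 ≤ j ∧ j ≤ (n : ℤ) then w ⟨(j - 1).toNat, by omega⟩
  else if h' : 1 ≤ -j ∧ -j ≤ (n : ℤ) then -w ⟨(-j - 1).toNat, by omega⟩
  else 0

/-- Vertically labelled lattice paths of type `Cₙ` (also of type `Bₙ`). -/
def VertC (n : ℕ) : Set (List Step × (Fin n → ℤ)) :=
  {p : List Step × (Fin n → ℤ) | IsLatticePath n n p.1 ∧ IsSignedPerm n p.2 ∧
    (∀ i : ℕ, IsRise p.1 i → evalSP p.2 (i : ℤ) < evalSP p.2 ((i : ℤ) + 1)) ∧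
    (p.1.head? = some Step.N → 0 < evalSP p.2 1)}

/-- The action of a signed permutation on `ℤⁿ`, determined by `u · e_i = sgn(u(i)) e_{|u(i)|}`. -/
def actSP (n : ℕ) (w : Fin n → ℤ) (x : Fin n → ℤ) : Fin n → ℤ :=
  fun k => ∑ i : Fin n, if |w i| = (k.val : ℤ) + 1 then (w i).sign * x i else 0

theorem ebn_le_count_s6 (l : List Step) (k : ℕ) : ebn l k ≤ l.count Step.E := by
  induction l generalizing k with
  | nil => cases k <;> simp [ebn]
  | cons s l ih =>
    cases s <;> cases k <;> simp [ebn, ih]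

theorem ebn_le_succ (l : List Step) (k : ℕ) : ebn l k ≤ ebn l (k + 1) := by
  induction l generalizing k with
  | nil => cases k <;> simp [ebn]
  | cons s l ih =>
    cases s <;> cases k <;> simp [ebn, ih]

theorem ebn_mono (l : List Step) : Monotone (ebn l) :=
  monotone_nat_of_le_succ (ebn_le_succ l)

theorem head?_eq_N_iff {l : List Step} (h : 0 < l.count Step.N) :
    l.head? = some Step.N ↔ ebn l 1 = 0 := by
  rcases l with _ | ⟨_ | _, l⟩ <;> simp [ebn] at *

theorem isRise_cons_E {l : List Step} {i : ℕ} : IsRise (Step.E :: l) i ↔ IsRise l i := by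
  constructor
  · rintro ⟨_ | p, h1, h2, h3⟩
    · simp at h1
    · exact ⟨p, by simpa using h1, by simpa using h2, by simpa using h3⟩
  · rintro ⟨p, h1, h2, h3⟩
    exact ⟨p + 1, by simpa using h1, by simpa using h2, by simpa using h3⟩

theorem isRise_cons_N {l : List Step} {i : ℕ} :
    IsRise (Step.N :: l) i ↔ (i = 1 ∧ l.head? = some Step.N) ∨ ∃ j, i = j + 1 ∧ IsRise l j := by
  constructor
  · rintro ⟨_ | p, h1, h2, h3⟩
    · left
      exact ⟨by simpa using h3.symm, by simpa [List.head?_eq_getElem?] using h2⟩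
    · exact .inr ⟨_, h3.symm, p, by simpa using h1, by simpa using h2, by simp⟩
  · rintro (⟨rfl, h⟩ | ⟨j, rfl, p, h1, h2, h3⟩)
    · exact ⟨0, by simp, by simpa [List.head?_eq_getElem?] using h, by simp⟩
    · exact ⟨p + 1, by simpa using h1, by simpa using h2, by simpa using h3⟩

theorem isRise_iff {l : List Step} {i : ℕ} :
    IsRise l i ↔ 1 ≤ i ∧ i + 1 ≤ l.count Step.N ∧ ebn l i = ebn l (i + 1) := by
  induction l generalizing i with
  | nil => simp [IsRise]
  | cons s l ih =>
    cases s with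
    | E =>
      rw [isRise_cons_E, ih]
      cases i <;> simp [ebn]
    | N =>
      rw [isRise_cons_N]
      simp only [ih]
      rcases i with _ | _ | i
      · simp
      · have h : l.head? = some Step.N → 0 < l.count Step.N := by
          rcases l with _ | ⟨_ | _, l⟩ <;> simp
        have h' := @head?_eq_N_iff l
        simp [ebn]
        grind
      · simp [ebn]

theorem latticePath_ext {l l' : List Step} (hE : l.count Step.E = l'.count Step.E)
    (hN : l.count Step.N = l'.count Step.N)
    (h : ∀ k < l.count Step.N, ebn l (k + 1) = ebn l' (k + 1)) : l = l' := by
  induction l generalizing l' with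
  | nil => rcases l' with _ | ⟨_ | _, l'⟩ <;> simp at *
  | cons s l ih =>
    rcases s with _ | _ <;> rcases l' with _ | ⟨_ | _, l'⟩
    · simp at hN
    · simp at hE hN
      rw [ih hE hN fun k hk => by simpa [ebn] using h (k + 1) (by simpa using hk)]
    · simpa [ebn] using h 0 (by simp)
    · simp at hE
    · simp at hN
      simpa [ebn] using h 0 (by simp [hN])
    · simp at hE hN
      rw [ih hE hN fun k hk => by simpa [ebn] using h k (by simpa using hk)]

theorem ebn_replicate_append (m : ℕ) (l : List Step) (k : ℕ) :
    ebn (List.replicate m Step.E ++ l) (k + 1) = ebn l (k + 1) + m := by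
  induction m with
  | zero => simp
  | succ m ih => simp [List.replicate_succ, ebn, ih]; omega

theorem exists_latticePath (a b : ℕ) (v : ℕ → ℕ)
    (hv : ∀ k, k + 1 < b → v k ≤ v (k + 1)) (ha : ∀ k < b, v k ≤ a) :
    ∃ l, IsLatticePath a b l ∧ ∀ k < b, ebn l (k + 1) = v k := by
  induction b generalizing a v with
  | zero => exact ⟨List.replicate a Step.E, by simp [IsLatticePath, List.count_replicate], by simp⟩
  | succ b ih =>
    have h0 : ∀ k < b + 1, v 0 ≤ v k := by
      intro k
      induction k with
      | zero => simp
      | succ k ihk => exact fun hk => (ihk (by omega)).trans (hv k hk)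
    obtain ⟨l, ⟨hlE, hlN⟩, hl⟩ := ih (a - v 0) (fun k => v (k + 1) - v 0)
      (fun k hk => Nat.sub_le_sub_right (hv (k + 1) (by omega)) _)
      (fun k hk => Nat.sub_le_sub_right (ha (k + 1) (by omega)) _)
    have ha0 := ha 0 (by omega)
    refine ⟨List.replicate (v 0) Step.E ++ Step.N :: l, ⟨?_, ?_⟩, fun k hk => ?_⟩
    · simp [hlE]; omega
    · simp [List.count_replicate, hlN]
    · rw [ebn_replicate_append]
      rcases k with _ | k
      · simp [ebn]
      · have := h0 (k + 1) hk
        rw [ebn, hl k (by omega)]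
        omega

theorem evalSP_succ {n : ℕ} (w : Fin n → ℤ) {k : ℕ} (hk : k < n) :
    evalSP w ((k : ℤ) + 1) = w ⟨k, hk⟩ := by
  rw [evalSP, dif_pos (by omega)]
  congr
  omega

theorem actSP_apply {n : ℕ} {w : Fin n → ℤ} (hw : IsSignedPerm n w) (x : Fin n → ℤ)
    {i k : Fin n} (h : |w i| = (k.val : ℤ) + 1) : actSP n w x k = (w i).sign * x i := by
  rw [actSP, Finset.sum_eq_single i, if_pos h]
  · exact fun j _ hj => if_neg fun hj' => hj (hw.2 (hj'.trans h.symm))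
  · simp

/-- The labels of a path, paired with the `x`-coordinates of the North steps carrying them. -/
def labelSeq {n : ℕ} (p : List Step × (Fin n → ℤ)) (i : Fin n) : ℕ ×ₗ ℤ :=
  toLex (ebn p.1 (i.val + 1), p.2 i)

theorem strictMono_labelSeq {n : ℕ} {p : List Step × (Fin n → ℤ)} (hp : p ∈ VertC n) :
    StrictMono (labelSeq p) := by
  obtain ⟨⟨-, hN⟩, -, hr, -⟩ := hp
  rcases n with _ | n
  · exact fun i => i.elim0
  rw [Fin.strictMono_iff_lt_succ]
  intro i
  rw [labelSeq, labelSeq, Prod.Lex.toLex_lt_toLex]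
  rcases (ebn_le_succ p.1 (i.val + 1)).lt_or_eq with h | h
  · exact .inl h
  · refine .inr ⟨h, ?_⟩
    have := hr (i.val + 1) (isRise_iff.2 ⟨by omega, by omega, h⟩)
    rw [evalSP_succ p.2 (k := i.val + 1) (by omega)] at this
    push_cast at this
    rwa [evalSP_succ p.2 (k := i.val) (by omega)] at this

theorem label_pos_of_ebn_eq_zero {n : ℕ} {p : List Step × (Fin n → ℤ)} (hp : p ∈ VertC n)
    {i : Fin n} (hi : ebn p.1 (i.val + 1) = 0) : 0 < p.2 i := by
  have hn : 0 < n := i.pos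
  have h0 : ebn p.1 1 = 0 :=
    Nat.eq_zero_of_le_zero (hi ▸ ebn_mono p.1 (show 1 ≤ i.val + 1 by omega))
  have hpos := hp.2.2.2 ((head?_eq_N_iff (hp.1.2.symm ▸ hn)).2 h0)
  have h1 : evalSP p.2 1 = p.2 ⟨0, hn⟩ := by simpa using evalSP_succ p.2 hn
  have hle := (strictMono_labelSeq hp).monotone (show (⟨0, hn⟩ : Fin n) ≤ i from Nat.zero_le _)
  simp only [labelSeq, Prod.Lex.toLex_le_toLex, zero_add, h0, hi] at hle
  simp at hle
  omega

/-- The index `k + 1`, with a sign making the corresponding coordinate nonnegative. -/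
def signedIndex {n : ℕ} (y : Fin n → ℤ) (k : Fin n) : ℤ :=
  if y k < 0 then -((k.val : ℤ) + 1) else (k.val : ℤ) + 1

theorem abs_signedIndex {n : ℕ} (y : Fin n → ℤ) (k : Fin n) :
    |signedIndex y k| = (k.val : ℤ) + 1 := by
  unfold signedIndex
  split_ifs
  · rw [abs_neg, abs_of_nonneg (by omega)]
  · rw [abs_of_nonneg (by omega)]

theorem sign_signedIndex_mul {n : ℕ} (y : Fin n → ℤ) (k : Fin n) :
    (signedIndex y k).sign * ((y k).natAbs : ℤ) = y k := by
  unfold signedIndex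
  split_ifs with h
  · rw [Int.sign_eq_neg_one_of_neg (by omega)]
    omega
  · rw [Int.sign_eq_one_of_pos (by omega)]
    omega

/-- The absolute values of the coordinates of `y`, paired with their signed indices. -/
def signedCoords {n : ℕ} (y : Fin n → ℤ) : Finset (ℕ ×ₗ ℤ) :=
  Finset.univ.image fun k => toLex ((y k).natAbs, signedIndex y k)

theorem card_signedCoords {n : ℕ} (y : Fin n → ℤ) : (signedCoords y).card = n := by
  rw [signedCoords, Finset.card_image_of_injective, Finset.card_univ, Fintype.card_fin]
  intro k k' h
  have h2 : signedIndex y k = signedIndex y k' := congrArg (fun q => (ofLex q).2) h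
  have := abs_signedIndex y k
  rw [h2, abs_signedIndex] at this
  exact Fin.ext (by omega)

theorem labelSeq_mem_signedCoords {n : ℕ} {p : List Step × (Fin n → ℤ)} (hp : p ∈ VertC n)
    {x : Fin n → ZMod (2 * n + 1)}
    (hx : ∀ k, ((actSP n p.2 (fun k : Fin n => (ebn p.1 (k.val + 1) : ℤ)) k : ℤ) :
      ZMod (2 * n + 1)) = x k) (i : Fin n) :
    labelSeq p i ∈ signedCoords fun k => (x k).valMinAbs := by
  obtain ⟨h1, h2⟩ := hp.2.1.1 i
  have hk : |p.2 i| = (((⟨(|p.2 i| - 1).toNat, by omega⟩ : Fin n).val : ℕ) : ℤ) + 1 := by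
    simp only
    omega
  generalize (⟨(|p.2 i| - 1).toNat, _⟩ : Fin n) = k at hk
  have hle : ebn p.1 (i.val + 1) ≤ n := (ebn_le_count_s6 _ _).trans hp.1.1.le
  have hz := @label_pos_of_ebn_eq_zero n p hp i
  have hxk := hx k
  rw [actSP_apply hp.2.1 _ hk] at hxk
  have hy : (x k).valMinAbs = (p.2 i).sign * (ebn p.1 (i.val + 1) : ℤ) := by
    rw [ZMod.valMinAbs_spec]
    refine ⟨hxk.symm, ?_⟩
    rcases Int.sign_trichotomy (p.2 i) with h | h | h <;> rw [h] <;> constructor <;>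
      push_cast <;> omega
  refine Finset.mem_image.2 ⟨k, Finset.mem_univ _, ?_⟩
  unfold labelSeq signedIndex
  simp only [hy]
  rcases lt_or_ge (p.2 i) 0 with h | h
  · rw [abs_of_neg h] at hk
    have : ebn p.1 (i.val + 1) ≠ 0 := fun h0 => by have := hz h0; omega
    rw [Int.sign_eq_neg_one_of_neg h, if_pos (by omega)]
    congr 2 <;> omega
  · rw [abs_of_nonneg h] at hk
    rw [Int.sign_eq_one_of_pos (by omega), if_neg (by omega)]
    congr 2 <;> omega

theorem labelSeq_injOn (n : ℕ) : Set.InjOn labelSeq (VertC n) := by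
  intro p hp q hq h
  refine Prod.ext ?_ (funext fun i => congrArg (fun q => (ofLex q).2) (congrFun h i))
  refine latticePath_ext (hp.1.1.trans hq.1.1.symm) (hp.1.2.trans hq.1.2.symm) fun k hk => ?_
  exact congrArg (fun q => (ofLex q).1) (congrFun h ⟨k, hk.trans_eq hp.1.2⟩)

theorem exists_mem_vertC {n : ℕ} {y : Fin n → ℤ} (hy : ∀ k, (y k).natAbs ≤ n) :
    ∃ p ∈ VertC n, ∀ k, actSP n p.2 (fun k : Fin n => (ebn p.1 (k.val + 1) : ℤ)) k = y k := by
  set f := (signedCoords y).orderEmbOfFin (card_signedCoords y) with hf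
  have hmem : ∀ i, ∃ k, (ofLex (f i)).1 = (y k).natAbs ∧ (ofLex (f i)).2 = signedIndex y k := by
    intro i
    obtain ⟨k, -, hk⟩ := Finset.mem_image.1 ((signedCoords y).orderEmbOfFin_mem
      (card_signedCoords y) i)
    exact ⟨k, by rw [hf, ← hk]; rfl, by rw [hf, ← hk]; rfl⟩
  have hlt : ∀ i j, i < j → (ofLex (f i)).1 < (ofLex (f j)).1 ∨
      (ofLex (f i)).1 = (ofLex (f j)).1 ∧ (ofLex (f i)).2 < (ofLex (f j)).2 := by
    intro i j hij
    exact Prod.Lex.lt_iff.1 (f.strictMono hij)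
  obtain ⟨l, hl, hlf⟩ := exists_latticePath n n
    (fun k => if h : k < n then (ofLex (f ⟨k, h⟩)).1 else 0)
    (by
      intro k hk
      rw [dif_pos hk, dif_pos (by omega)]
      rcases hlt ⟨k, by omega⟩ ⟨k + 1, hk⟩ (by simp) with h | h
      · exact h.le
      · exact h.1.le)
    (by
      intro k hk
      obtain ⟨j, hj, -⟩ := hmem ⟨k, hk⟩
      rw [dif_pos hk, hj]
      exact hy j)
  have hebn : ∀ i : Fin n, ebn l (i.val + 1) = (ofLex (f i)).1 := by
    intro i
    rw [hlf i i.2, dif_pos i.2]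
  have hsp : IsSignedPerm n fun i => (ofLex (f i)).2 := by
    constructor
    · intro i
      obtain ⟨k, -, hk⟩ := hmem i
      simp only [hk, abs_signedIndex]
      omega
    · intro i j hij
      obtain ⟨k, hk1, hk2⟩ := hmem i
      obtain ⟨k', hk1', hk2'⟩ := hmem j
      simp only [hk2, hk2', abs_signedIndex] at hij
      obtain rfl : k = k' := Fin.ext (by omega)
      exact f.injective (ofLex.injective (Prod.ext (hk1.trans hk1'.symm) (hk2.trans hk2'.symm)))
  refine ⟨(l, fun i => (ofLex (f i)).2), ⟨hl, hsp, ?_, ?_⟩, fun k => ?_⟩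
  · intro i hi
    obtain ⟨h1, h2, h3⟩ := isRise_iff.1 hi
    obtain ⟨i, rfl⟩ := Nat.exists_eq_add_of_le' h1
    simp only [hl.2] at h2
    have e1 := hebn ⟨i, by omega⟩
    have e2 := hebn ⟨i + 1, by omega⟩
    have := hlt ⟨i, by omega⟩ ⟨i + 1, by omega⟩ (by simp)
    rw [evalSP_succ _ (k := i + 1) (by omega)]
    push_cast
    rw [evalSP_succ _ (k := i) (by omega)]
    simp only at e1 e2 h3
    omega
  · intro hhead
    have hn : 0 < n := by
      by_contra h
      obtain rfl : n = 0 := by omega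
      rcases l with _ | ⟨_ | _, l⟩ <;> simp [IsLatticePath] at hhead hl
    have h0 : ebn l 1 = 0 := (head?_eq_N_iff (hl.2.symm ▸ hn)).1 hhead
    have e := evalSP_succ (fun i => (ofLex (f i)).2) hn
    have e0 := hebn ⟨0, hn⟩
    obtain ⟨k, hk1, hk2⟩ := hmem ⟨0, hn⟩
    simp only [Nat.cast_zero, zero_add] at e e0
    rw [e, hk2, signedIndex, if_neg (by omega)]
    omega
  · have hk : toLex ((y k).natAbs, signedIndex y k) ∈ Set.range f := by
      rw [hf, Finset.range_orderEmbOfFin]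
      exact Finset.mem_coe.2 (Finset.mem_image_of_mem _ (Finset.mem_univ k))
    obtain ⟨i, hi⟩ := hk
    rw [actSP_apply (i := i) hsp _ (by simp [hi, abs_signedIndex])]
    simp only [hebn, hi, ofLex_toLex]
    exact sign_signedIndex_mul y k

/-- The map `ψ : Vert(Cₙ) → ℤⁿ/(2n+1)ℤⁿ`, `(π,u) ↦ u·λ(π) mod (2n+1)`,
where `λ(π)_k` is the number of East steps of `π` preceding its `k`-th North step,
is a bijection. -/
theorem psiC_bijOn (n : ℕ) (hn : 1 ≤ n) :
    Set.BijOn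
      (fun p : List Step × (Fin n → ℤ) =>
        (fun i : Fin n =>
          ((actSP n p.2 (fun k : Fin n => (ebn p.1 (k.val + 1) : ℤ))) i : ZMod (2 * n + 1))))
      (VertC n) (Set.univ : Set (Fin n → ZMod (2 * n + 1))) := by
  refine ⟨fun _ _ => Set.mem_univ _, fun p hp q hq hpq => labelSeq_injOn n hp hq ?_, fun x _ => ?_⟩
  · rw [Finset.orderEmbOfFin_unique (card_signedCoords _)
        (labelSeq_mem_signedCoords hp fun k => congrFun hpq k) (strictMono_labelSeq hp),
      Finset.orderEmbOfFin_unique (card_signedCoords _)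
        (labelSeq_mem_signedCoords hq fun _ => rfl) (strictMono_labelSeq hq)]
  · obtain ⟨p, hp, h⟩ := exists_mem_vertC (n := n) (y := fun k => (x k).valMinAbs) fun k =>
      (ZMod.natAbs_valMinAbs_le _).trans (by omega)
    exact ⟨p, hp, funext fun k => by simp [h]⟩
end

section
/- Let n ≥ 1 and let μ be the type C_n area vector of a lattice path π ∈ L_{n,n}. Then: (i) if 1 ≤ i < j ≤ n, μ_j = μ_i − 1 and μ_ℓ ∉ {μ_i − 1, μ_i} for all ℓ with i < ℓ < j, then j = i+1; (ii) μ_i ≤ μ_{i+1} + 1 for all 1 ≤ i ≤ n−1; (iii) if μ_j < 0 for some j then there exists i < j with μ_i = μ_j + 1; (iv) if μ_i > 1 for some i then there exists j > i with μ_j = μ_i − 1; (v) if μ_i = 1 and μ_ℓ ∉ {0,1} for all ℓ > i, then i = n. -/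
theorem ebn_le_count_east (π : List Step) (k : ℕ) : ebn π k ≤ π.count Step.E := by
  induction π generalizing k with
  | nil => cases k <;> simp [ebn]
  | cons s π ih =>
    cases k with
    | zero => simp [ebn]
    | succ k => cases s <;> simp [ebn, ih]

theorem ebn_le_ebn_succ (π : List Step) (k : ℕ) (hk : k + 1 ≤ π.count Step.N) :
    ebn π k ≤ ebn π (k + 1) := by
  induction π generalizing k with
  | nil => simp at hk
  | cons s π ih =>
    cases k with
    | zero => simp [ebn]
    | succ k =>
      cases s
      · simp only [ebn]
        exact ih k (by simpa using hk)
      · simp only [ebn]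
        exact Nat.succ_le_succ (ih (k + 1) (by simpa using hk))

/-- A discrete intermediate value theorem for integer sequences descending by at most one. -/
theorem exists_eq_of_le_succ_add_one (f : ℕ → ℤ) {a b : ℕ} (hab : a ≤ b) {v : ℤ}
    (hf : ∀ k, a ≤ k → k < b → f k ≤ f (k + 1) + 1) (ha : v ≤ f a) (hb : f b ≤ v) :
    ∃ c, a ≤ c ∧ c ≤ b ∧ f c = v := by
  induction b, hab using Nat.le_induction with
  | base => exact ⟨a, le_rfl, le_rfl, le_antisymm hb ha⟩
  | succ b hab ih =>
    by_cases h : f b ≤ v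
    · obtain ⟨c, hac, hcb, hc⟩ := ih (fun k hk hkb => hf k hk (by omega)) h
      exact ⟨c, hac, by omega, hc⟩
    · exact ⟨b + 1, by omega, le_rfl, by have := hf b hab (by omega); omega⟩

theorem areaC_le_areaC_succ_add_one (n : ℕ) (π : List Step) (hN : π.count Step.N = n) (i : ℕ)
    (hi : 1 ≤ i) (hin : i + 1 ≤ n) : areaC n π i ≤ areaC n π (i + 1) + 1 := by
  have h := ebn_le_ebn_succ π (n - i) (by omega)
  have h₁ : n + 1 - i = n - i + 1 := by omega
  have h₂ : n + 1 - (i + 1) = n - i := by omega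
  simp only [areaC, h₁, h₂]
  push_cast
  omega

theorem areaC_one_nonneg (n : ℕ) (π : List Step) (hE : π.count Step.E = n) :
    0 ≤ areaC n π 1 := by
  have h := ebn_le_count_east π n
  simp only [areaC, Nat.add_sub_cancel]
  push_cast
  omega

theorem areaC_self_le_one (n : ℕ) (π : List Step) : areaC n π n ≤ 1 := by
  simp only [areaC]
  omega

/-- Structural properties of the type `Cₙ` area vector. -/
theorem areaC_properties (n : ℕ) (hn : 1 ≤ n) (π : List Step)
    (hπ : IsLatticePath n n π) :
    (∀ i j : ℕ, 1 ≤ i → i < j → j ≤ n → areaC n π j = areaC n π i - 1 →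
      (∀ l : ℕ, i < l → l < j → areaC n π l ≠ areaC n π i - 1 ∧ areaC n π l ≠ areaC n π i) →
      j = i + 1) ∧
    (∀ i : ℕ, 1 ≤ i → i + 1 ≤ n → areaC n π i ≤ areaC n π (i + 1) + 1) ∧
    (∀ j : ℕ, 1 ≤ j → j ≤ n → areaC n π j < 0 →
      ∃ i : ℕ, 1 ≤ i ∧ i < j ∧ areaC n π i = areaC n π j + 1) ∧
    (∀ i : ℕ, 1 ≤ i → i ≤ n → 1 < areaC n π i →
      ∃ j : ℕ, i < j ∧ j ≤ n ∧ areaC n π j = areaC n π i - 1) ∧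
    (∀ i : ℕ, 1 ≤ i → i ≤ n → areaC n π i = 1 →
      (∀ l : ℕ, i < l → l ≤ n → areaC n π l ≠ 0 ∧ areaC n π l ≠ 1) → i = n) := by
  have step := areaC_le_areaC_succ_add_one n π hπ.2
  have first := areaC_one_nonneg n π hπ.1
  have last := areaC_self_le_one n π
  generalize areaC n π = f at *
  refine ⟨fun i j hi hij hjn hj hl => ?_, step, fun j hj hjn hneg => ?_,
    fun i hi hin hpos => ?_, fun i hi hin hone hl => ?_⟩
  · by_contra hne
    obtain ⟨j, rfl⟩ : ∃ m, j = m + 1 := ⟨j - 1, by omega⟩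
    have hfi := step i hi (by omega)
    have hfj := step j (by omega) hjn
    have hlj := hl j (by omega) (by omega)
    obtain ⟨c, hc, hcj, hfc⟩ := exists_eq_of_le_succ_add_one f (a := i + 1) (b := j)
      (v := f i - 1) (by omega) (fun k _ _ => step k (by omega) (by omega))
      (by omega) (by omega)
    exact (hl c (by omega) (by omega)).1 hfc
  · obtain ⟨c, hc, hcj, hfc⟩ := exists_eq_of_le_succ_add_one f hj (v := f j + 1)
      (fun k _ _ => step k (by omega) (by omega)) (by omega) (by omega)
    have hne : c ≠ j := by rintro rfl; omega
    exact ⟨c, hc, by omega, hfc⟩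
  · obtain ⟨c, hc, hcn, hfc⟩ := exists_eq_of_le_succ_add_one f hin (v := f i - 1)
      (fun k _ _ => step k (by omega) (by omega)) (by omega) (by omega)
    have hne : c ≠ i := by rintro rfl; omega
    exact ⟨c, by omega, hcn, hfc⟩
  · by_contra hne
    have hln := hl n (by omega) le_rfl
    obtain ⟨c, hc, hcn, hfc⟩ := exists_eq_of_le_succ_add_one f hin (v := 0)
      (fun k _ _ => step k (by omega) (by omega)) (by omega) (by omega)
    have hci : c ≠ i := by rintro rfl; omega
    exact (hl c (by omega) hcn).1 hfc
end
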